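/- Let a < 0. There do not exist differentiable functions m, γ : [0,∞) → ℝ satisfying m'(t) = (1/2)·γ(t)² − (1/2)·m(t)² + a and γ'(t) = −γ(t)·m(t) for all t ≥ 0, with γ(0) = 0. -/

import Mathlib

open Real Set

/-- A solution on `[0, ∞)` of the scalar linear equation `y' = -(y * p)` with continuous
coefficient and `y 0 = 0` vanishes identically. -/
theorem eq_zero_of_hasDerivWithinAt_neg_mul {p y : ℝ → ℝ} (hp : ContinuousOn p (Ici 0))
    (hy : ∀ t ∈ Ici (0 : ℝ), HasDerivWithinAt y (-(y t * p t)) (Ici 0) t) (hy0 : y 0 = 0) :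
    ∀ t ∈ Ici (0 : ℝ), y t = 0 := by
  intro T hT
  obtain ⟨C, hC⟩ := isCompact_Icc.exists_bound_of_continuousOn
    (hp.mono (Icc_subset_Ici_self : Icc 0 T ⊆ Ici 0))
  refine eq_zero_of_abs_deriv_le_mul_abs_self_of_eq_zero_right (K := C) (a := 0) (b := T)
    (f' := fun t => -(y t * p t))
    (fun t ht => ((hy t ht.1).mono Icc_subset_Ici_self).continuousWithinAt)
    (fun t ht => (hy t ht.1).mono (Ici_subset_Ici.2 ht.1)) hy0 (fun t ht => ?_) T ⟨hT, le_rfl⟩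
  rw [norm_neg, norm_mul, mul_comm]
  gcongr
  exact hC t ⟨ht.1, ht.2.le⟩

/-- The Riccati equation `y' = -y ^ 2 / 2 + a` with `a < 0` has no solution on `[0, ∞)`:
`arctan (y / √(-2 * a))` would decrease with constant slope. -/
theorem not_forall_hasDerivWithinAt_riccati {a : ℝ} (ha : a < 0) (y : ℝ → ℝ) :
    ¬ ∀ t ∈ Ici (0 : ℝ), HasDerivWithinAt y (-(1 / 2) * y t ^ 2 + a) (Ici 0) t := by
  intro hy
  set s := √(-2 * a)
  have hs : 0 < s := Real.sqrt_pos.2 (by linarith)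
  have hs2 : s ^ 2 = -2 * a := Real.sq_sqrt (by linarith)
  have hderiv : ∀ t ∈ Ici (0 : ℝ),
      HasDerivWithinAt (fun t => arctan (y t / s) + s / 2 * t) 0 (Ici 0) t := by
    intro t ht
    refine (((hy t ht).div_const s).arctan.add
      ((hasDerivWithinAt_id t (Ici 0)).const_mul (s / 2))).congr_deriv ?_
    have ha' : a = -s ^ 2 / 2 := by linarith
    have hpos : s ^ 2 + y t ^ 2 ≠ 0 := by positivity
    rw [ha']
    field_simp
    ring
  have hT : 0 ≤ 2 * π / s := by positivity
  have h := constant_of_has_deriv_right_zero (a := 0) (b := 2 * π / s)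
    (fun t ht => ((hderiv t ht.1).mono Icc_subset_Ici_self).continuousWithinAt)
    (fun t ht => (hderiv t ht.1).mono (Ici_subset_Ici.2 ht.1)) _ ⟨hT, le_rfl⟩
  have hmul : s / 2 * (2 * π / s) = π := by field_simp
  simp only [hmul, mul_zero, add_zero] at h
  linarith [neg_pi_div_two_lt_arctan (y (2 * π / s) / s), arctan_lt_pi_div_two (y 0 / s)]

theorem ode_system_no_global_solution_neg_a (a : ℝ) (ha : a < 0) :
    ¬ ∃ m γ : ℝ → ℝ,
      (∀ t ∈ Set.Ici (0:ℝ),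
        HasDerivWithinAt m ((1 / 2) * (γ t) ^ 2 - (1 / 2) * (m t) ^ 2 + a) (Set.Ici (0:ℝ)) t) ∧
      (∀ t ∈ Set.Ici (0:ℝ),
        HasDerivWithinAt γ (-(γ t * m t)) (Set.Ici (0:ℝ)) t) ∧
      γ 0 = 0 := by
  rintro ⟨m, γ, hm, hγ, hγ0⟩
  have hzero := eq_zero_of_hasDerivWithinAt_neg_mul
    (fun t ht => (hm t ht).continuousWithinAt) hγ hγ0
  refine not_forall_hasDerivWithinAt_riccati ha m fun t ht => (hm t ht).congr_deriv ?_
  rw [hzero t ht]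
  ring
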